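/- arXiv:2110.09323 — 5 statements merged into one kernel-verified Lean document; each statement's English description precedes it below -/
import Mathlib

section
/- For every δ with 0 < δ < 1/2, lim_{k→∞} Γ(k−1, k − k^{1/2+δ}) / (k−2)! = 1, where the limit is over integers k → ∞. -/
open Real Filter Topology MeasureTheory

/-- The upper incomplete gamma function `Γ(s, x) = ∫_x^∞ t^(s−1) e^(−t) dt`. -/
noncomputable def upperGamma (s x : ℝ) : ℝ :=
  ∫ t in Set.Ioi x, t ^ (s - 1) * Real.exp (-t)

lemma aux_int (n : ℕ) : IntegrableOn (fun t : ℝ => t ^ n * Real.exp (-t)) (Set.Ioi 0) ∧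
    ∫ t in Set.Ioi (0:ℝ), t ^ n * Real.exp (-t) = (n.factorial : ℝ) := by
  have h1 := Real.GammaIntegral_convergent (s := (n:ℝ) + 1) (by positivity)
  have h2 := Real.Gamma_eq_integral (s := (n:ℝ) + 1) (by positivity)
  have e : (fun t : ℝ => Real.exp (-t) * t ^ ((n:ℝ) + 1 - 1)) =
      fun t : ℝ => t ^ n * Real.exp (-t) := by
    funext t
    rw [add_sub_cancel_right, Real.rpow_natCast, mul_comm]
  rw [e] at h1 h2
  rw [Real.Gamma_nat_eq_factorial] at h2
  exact ⟨h1, h2.symm⟩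

lemma aux_var (n : ℕ) :
    IntegrableOn (fun t : ℝ => (t - (n + 1)) ^ 2 * (t ^ n * Real.exp (-t))) (Set.Ioi 0) ∧
    ∫ t in Set.Ioi (0:ℝ), (t - (n + 1)) ^ 2 * (t ^ n * Real.exp (-t))
      = (n + 1) * (n.factorial : ℝ) := by
  obtain ⟨i0, e0⟩ := aux_int n
  obtain ⟨i1, e1⟩ := aux_int (n + 1)
  obtain ⟨i2, e2⟩ := aux_int (n + 2)
  have e : (fun t : ℝ => (t - (n + 1)) ^ 2 * (t ^ n * Real.exp (-t))) = fun t : ℝ =>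
      (t ^ (n + 2) * Real.exp (-t) - (2 * ((n:ℝ) + 1)) * (t ^ (n + 1) * Real.exp (-t)))
        + ((n:ℝ) + 1) ^ 2 * (t ^ n * Real.exp (-t)) := by
    funext t
    ring
  have j1 := i1.const_mul (2 * ((n:ℝ) + 1))
  have j2 : Integrable (fun t : ℝ => t ^ (n + 2) * Real.exp (-t)
      - (2 * ((n:ℝ) + 1)) * (t ^ (n + 1) * Real.exp (-t)))
      (volume.restrict (Set.Ioi 0)) := i2.sub j1
  have j0 := i0.const_mul (((n:ℝ) + 1) ^ 2)
  rw [e]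
  refine ⟨j2.add j0, ?_⟩
  rw [integral_add j2 j0, integral_sub i2 j1, integral_const_mul, integral_const_mul,
    e0, e1, e2, Nat.factorial_succ (n + 1), Nat.factorial_succ n]
  push_cast
  ring

lemma aux_bound (n : ℕ) (x : ℝ) (hx0 : 0 ≤ x) (hx : x < n + 1) :
    ∫ t in Set.Ioi x, t ^ n * Real.exp (-t) ≤ (n.factorial : ℝ) ∧
    (n.factorial : ℝ) - (n + 1) * (n.factorial : ℝ) / (n + 1 - x) ^ 2 ≤
      ∫ t in Set.Ioi x, t ^ n * Real.exp (-t) := by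
  obtain ⟨i0, e0⟩ := aux_int n
  obtain ⟨iv, ev⟩ := aux_var n
  have hs1 : Set.Ioc 0 x ⊆ Set.Ioi (0:ℝ) := Set.Ioc_subset_Ioi_self
  have hs2 : Set.Ioi x ⊆ Set.Ioi (0:ℝ) := Set.Ioi_subset_Ioi hx0
  have hsplit : ∫ t in Set.Ioi (0:ℝ), t ^ n * Real.exp (-t) =
      (∫ t in Set.Ioc 0 x, t ^ n * Real.exp (-t)) + ∫ t in Set.Ioi x, t ^ n * Real.exp (-t) := by
    rw [← Set.Ioc_union_Ioi_eq_Ioi hx0]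
    exact setIntegral_union (Set.Ioc_disjoint_Ioi le_rfl) measurableSet_Ioi
      (i0.mono_set hs1) (i0.mono_set hs2)
  have hnn : 0 ≤ ∫ t in Set.Ioc 0 x, t ^ n * Real.exp (-t) := by
    apply setIntegral_nonneg measurableSet_Ioc
    intro t ht
    have := ht.1
    positivity
  have hd : 0 < (n:ℝ) + 1 - x := by linarith
  have hup : (n + 1 - x) ^ 2 * ∫ t in Set.Ioc 0 x, t ^ n * Real.exp (-t)
      ≤ (n + 1) * (n.factorial : ℝ) := by
    rw [← ev, ← integral_const_mul]
    calc _ ≤ ∫ t in Set.Ioc 0 x, (t - (n + 1)) ^ 2 * (t ^ n * Real.exp (-t)) := by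
          apply setIntegral_mono_on ((i0.mono_set hs1).const_mul _) (iv.mono_set hs1)
            measurableSet_Ioc
          intro t ht
          have h0 := ht.1
          have h1 := ht.2
          apply mul_le_mul_of_nonneg_right _ (by positivity)
          nlinarith
      _ ≤ _ := by
          apply setIntegral_mono_set iv _ hs1.eventuallyLE
          filter_upwards [ae_restrict_mem measurableSet_Ioi] with t ht
          have h0 : 0 < t := ht
          simp only [Pi.zero_apply]
          positivity
  have : ∫ t in Set.Ioc 0 x, t ^ n * Real.exp (-t) ≤
      (n + 1) * (n.factorial : ℝ) / (n + 1 - x) ^ 2 := by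
    rw [le_div_iff₀ (by positivity)]
    linarith
  constructor <;> linarith

/-- For every `0 < δ < 1/2`,
`lim_{k→∞} Γ(k−1, k − k^(1/2+δ)) / (k−2)! = 1`. -/
theorem upperGamma_div_factorial_tendsto_one (δ : ℝ) (hδ0 : 0 < δ) (hδ : δ < 1 / 2) :
    Tendsto (fun k : ℕ =>
        upperGamma ((k : ℝ) - 1) ((k : ℝ) - (k : ℝ) ^ ((1 : ℝ) / 2 + δ))
          / (Nat.factorial (k - 2) : ℝ))
      atTop (𝓝 1) := by
  have hy : ∀ᶠ k : ℕ in atTop, (2:ℝ) ≤ (k:ℝ) ^ ((1 : ℝ) / 2 + δ) :=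
    ((tendsto_rpow_atTop (by linarith : 0 < (1:ℝ)/2 + δ)).comp
      tendsto_natCast_atTop_atTop).eventually_ge_atTop 2
  have key : ∀ᶠ k : ℕ in atTop,
      1 - 4 * (k:ℝ) ^ (-(2 * δ)) ≤ upperGamma ((k : ℝ) - 1)
        ((k : ℝ) - (k : ℝ) ^ ((1 : ℝ) / 2 + δ)) / (Nat.factorial (k - 2) : ℝ) ∧
      upperGamma ((k : ℝ) - 1)
        ((k : ℝ) - (k : ℝ) ^ ((1 : ℝ) / 2 + δ)) / (Nat.factorial (k - 2) : ℝ) ≤ 1 := by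
    filter_upwards [hy, eventually_ge_atTop 2] with k hk2 hk
    obtain ⟨n, rfl⟩ := Nat.exists_eq_add_of_le' hk
    have hkpos : (0:ℝ) < ((n + 2 : ℕ) : ℝ) := by positivity
    have hk1 : (1:ℝ) ≤ ((n + 2 : ℕ) : ℝ) := by exact_mod_cast (by omega : 1 ≤ n + 2)
    have hle : ((n + 2 : ℕ) : ℝ) ^ ((1 : ℝ) / 2 + δ) ≤ ((n + 2 : ℕ) : ℝ) := by
      simpa using Real.rpow_le_rpow_of_exponent_le hk1 (by linarith : (1:ℝ)/2 + δ ≤ 1)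
    have hsq : ((n + 2 : ℕ) : ℝ) ^ (-(2 * δ)) * (((n + 2 : ℕ) : ℝ) ^ ((1 : ℝ) / 2 + δ)) ^ 2
        = ((n + 2 : ℕ) : ℝ) := by
      rw [← Real.rpow_natCast, ← Real.rpow_mul hkpos.le, ← Real.rpow_add hkpos]
      conv_rhs => rw [← Real.rpow_one ((n + 2 : ℕ) : ℝ)]
      congr 1
      push_cast
      ring
    have hz : 0 < ((n + 2 : ℕ) : ℝ) ^ (-(2 * δ)) := by positivity
    have hK : ((n + 2 : ℕ) : ℝ) = n + 2 := by push_cast; ring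
    generalize ((n + 2 : ℕ) : ℝ) ^ ((1 : ℝ) / 2 + δ) = y at *
    generalize ((n + 2 : ℕ) : ℝ) ^ (-(2 * δ)) = z at *
    rw [hK] at *
    have hG : upperGamma ((n:ℝ) + 2 - 1) ((n:ℝ) + 2 - y) =
        ∫ t in Set.Ioi ((n:ℝ) + 2 - y), t ^ n * Real.exp (-t) := by
      unfold upperGamma
      congr 1
      funext t
      rw [show (n:ℝ) + 2 - 1 - 1 = n by ring, Real.rpow_natCast]
    obtain ⟨b1, b2⟩ := aux_bound n ((n:ℝ) + 2 - y) (by linarith) (by linarith)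
    rw [← hG] at b1 b2
    rw [Nat.add_sub_cancel]
    have hf : (0:ℝ) < n.factorial := by exact_mod_cast n.factorial_pos
    refine ⟨?_, (div_le_one hf).2 b1⟩
    rw [le_div_iff₀ hf]
    refine le_trans ?_ b2
    have : ((n:ℝ) + 1) / (n + 1 - (n + 2 - y)) ^ 2 ≤ 4 * z := by
      rw [show (n:ℝ) + 1 - (n + 2 - y) = y - 1 by ring, div_le_iff₀ (by nlinarith)]
      have : y ^ 2 ≤ 4 * (y - 1) ^ 2 := by nlinarith
      nlinarith
    have h3 := mul_le_mul_of_nonneg_right this hf.le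
    rw [mul_div_right_comm]
    linarith
  have hlim : Tendsto (fun k : ℕ => 1 - 4 * (k:ℝ) ^ (-(2 * δ))) atTop (𝓝 1) := by
    have := ((tendsto_rpow_neg_atTop (by linarith : 0 < 2 * δ)).comp
      (tendsto_natCast_atTop_atTop (R := ℝ))).const_mul 4 |>.const_sub 1
    simpa using this
  exact tendsto_of_tendsto_of_tendsto_of_le_of_le' hlim tendsto_const_nhds
    (key.mono fun _ h => h.1) (key.mono fun _ h => h.2)
end

section
/- Let a : ℕ → (0,∞) be a summable sequence of positive real numbers such that the sequence a(n+1)/a(n) is nonincreasing. Let f : (0,∞) → (0,∞) be a continuous function with f(n) = a(n) for all positive integers n, and suppose there is τ ∈ (0,∞) such that f is monotone increasing on (0,τ) and monotone decreasing on (τ,∞). Then for every positive integer k, ∑_{n=k+1}^∞ a(n) ≤ max{ a(k+1)/a(k), 1 } · ∫_k^∞ f(x) dx. -/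
open MeasureTheory

/-- If `a` is a summable sequence of positive reals whose ratio
`a(n+1)/a(n)` is nonincreasing, and `f : (0,∞) → (0,∞)` is continuous, agrees with `a`
on the positive integers, and is increasing on `(0,τ)` and decreasing on `(τ,∞)`, then
for every positive integer `k`, `∑_{n=k+1}^∞ a(n) ≤ max{a(k+1)/a(k), 1} · ∫_k^∞ f`. -/
theorem tsum_tail_le_max_ratio_mul_integral
    (a : ℕ → ℝ) (f : ℝ → ℝ) (τ : ℝ) (hτ : τ ∈ Set.Ioi (0 : ℝ))
    (ha_pos : ∀ n, 0 < a n)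
    (ha_sum : Summable a)
    (ha_ratio : Antitone fun n => a (n + 1) / a n)
    (hf_pos : ∀ x : ℝ, 0 < x → 0 < f x)
    (hf_cont : ContinuousOn f (Set.Ioi (0 : ℝ)))
    (hfa : ∀ n : ℕ, 0 < n → f n = a n)
    (hf_mono : MonotoneOn f (Set.Ioo (0 : ℝ) τ))
    (hf_anti : AntitoneOn f (Set.Ioi τ))
    (k : ℕ) (hk : 0 < k) :
    ∑' n : ℕ, a (k + 1 + n) ≤
      max (a (k + 1) / a k) 1 * ∫ x in Set.Ioi (k : ℝ), f x := by
  have hτ0 : 0 < τ := hτ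
  -- quasi-concavity
  have hqc : ∀ p x q : ℝ, 0 < p → p ≤ x → x ≤ q → min (f p) (f q) ≤ f x := by
    intro p x q hp hpx hxq
    rcases lt_trichotomy x τ with h | h | h
    · exact (min_le_left _ _).trans
        (hf_mono ⟨hp, hpx.trans_lt h⟩ ⟨hp.trans_le hpx, h⟩ hpx)
    · rcases hpx.eq_or_lt with h' | h'
      · subst h'; exact min_le_left _ _
      · refine (min_le_left _ _).trans ?_
        subst h
        have hc : Filter.Tendsto f (nhdsWithin x (Set.Iio x)) (nhds (f x)) :=
          ((hf_cont.continuousAt (Ioi_mem_nhds hτ0)).tendsto).mono_left nhdsWithin_le_nhds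
        refine ge_of_tendsto hc ?_
        filter_upwards [Ioo_mem_nhdsLT h'] with y hy
        exact hf_mono ⟨hp, h'⟩ ⟨hp.trans hy.1, hy.2⟩ hy.1.le
    · exact (min_le_right _ _).trans (hf_anti h (h.trans_le hxq) hxq)
  have hii : ∀ p q : ℝ, 0 < p → p ≤ q → IntervalIntegrable f volume p q := by
    intro p q hp hpq
    apply ContinuousOn.intervalIntegrable
    rw [Set.uIcc_of_le hpq]
    exact hf_cont.mono fun x hx => hp.trans_le hx.1
  have hk0 : (0 : ℝ) < k := by exact_mod_cast hk
  -- integrability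
  have hint : IntegrableOn f (Set.Ioi (k : ℝ)) := by
    obtain ⟨N, hN⟩ := exists_nat_gt (max τ k)
    have hNτ : τ < N := (le_max_left _ _).trans_lt hN
    have hNk : (k : ℝ) < N := (le_max_right _ _).trans_lt hN
    have hN0 : (0 : ℝ) < N := hk0.trans hNk
    have hNn : 0 < N := by exact_mod_cast hN0
    have h1 : IntegrableOn f (Set.Ioc (k : ℝ) N) :=
      (intervalIntegrable_iff_integrableOn_Ioc_of_le hNk.le).1 (hii _ _ hk0 hNk.le)
    have h2 : IntegrableOn f (Set.Ioi (N : ℝ)) := by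
      refine integrableOn_Ioi_of_intervalIntegral_norm_bounded (∑' n, a n) (N : ℝ)
        (l := Filter.atTop) (b := fun j : ℕ => (N : ℝ) + j) ?_ ?_ ?_
      · intro j
        exact (intervalIntegrable_iff_integrableOn_Ioc_of_le (by simp)).1
          (hii _ _ hN0 (by simp))
      · exact Filter.tendsto_atTop_add_const_left _ _ tendsto_natCast_atTop_atTop
      · refine Filter.Eventually.of_forall fun j => ?_
        have e : ∫ x in (N : ℝ)..(N : ℝ) + j, ‖f x‖ = ∫ x in (N : ℝ)..(N : ℝ) + j, f x := by
          apply intervalIntegral.integral_congr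
          intro x hx
          rw [Set.uIcc_of_le (by simp)] at hx
          exact abs_of_pos (hf_pos x (hN0.trans_le hx.1))
        rw [e]
        refine (AntitoneOn.integral_le_sum (hf_anti.mono fun x hx => hNτ.trans_le hx.1)).trans ?_
        have e2 : ∀ i ∈ Finset.range j, f ((N : ℝ) + i) = a (N + i) := by
          intro i _
          rw [← hfa (N + i) (by omega)]; push_cast; rfl
        rw [Finset.sum_congr rfl e2]
        have hs : Summable fun i => a (N + i) := by
          simpa [add_comm] using (summable_nat_add_iff N).2 ha_sum
        refine (hs.sum_le_tsum _ fun i _ => (ha_pos _).le).trans ?_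
        exact (hs.tsum_le_tsum_of_inj (fun i => N + i) (fun x y h => by simpa using h)
          (fun c _ => (ha_pos c).le) (fun i => le_rfl) ha_sum)
    rw [← Set.Ioc_union_Ioi_eq_Ioi hNk.le]
    exact h1.union h2
  set M := max (a (k + 1) / a k) 1 with hM
  have hM1 : 1 ≤ M := le_max_right _ _
  have hM0 : 0 ≤ M := zero_le_one.trans hM1
  have hterm : ∀ n, k ≤ n → a (n + 1) ≤ M * ∫ x in (n : ℝ)..((n + 1 : ℕ) : ℝ), f x := by
    intro n hn
    have hn0 : (0 : ℝ) < n := by exact_mod_cast hk.trans_le hn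
    have hle : (n : ℝ) ≤ ((n + 1 : ℕ) : ℝ) := by push_cast; linarith
    have h1 : min (a n) (a (n + 1)) ≤ ∫ x in (n : ℝ)..((n + 1 : ℕ) : ℝ), f x := by
      have := intervalIntegral.integral_mono_on (μ := volume)
        (f := fun _ => min (a n) (a (n + 1))) (g := f) hle
        (by simp) (hii _ _ hn0 hle) (fun x hx => by
          have := hqc n x ((n + 1 : ℕ) : ℝ) hn0 hx.1 hx.2
          rwa [hfa n (hk.trans_le hn), hfa (n + 1) (by omega)] at this)
      simpa using this
    refine le_trans ?_ (mul_le_mul_of_nonneg_left h1 hM0)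
    rcases min_choice (a n) (a (n + 1)) with h | h
    · rw [h]
      have h3 : a (n + 1) / a n ≤ a (k + 1) / a k := ha_ratio hn
      exact (div_le_iff₀ (ha_pos n)).1 (h3.trans (le_max_left _ _))
    · rw [h]
      nlinarith [ha_pos (n + 1)]
  refine Real.tsum_le_of_sum_range_le (fun n => (ha_pos _).le) fun j => ?_
  have hsum : ∑ i ∈ Finset.range j, ∫ x in ((k + i : ℕ) : ℝ)..((k + (i + 1) : ℕ) : ℝ), f x
      = ∫ x in (k : ℝ)..((k + j : ℕ) : ℝ), f x := by
    have := intervalIntegral.sum_integral_adjacent_intervals (μ := volume) (f := f)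
      (a := fun i : ℕ => ((k + i : ℕ) : ℝ)) (n := j) (fun i _ => hii _ _ (by positivity)
        (by push_cast; linarith))
    simpa using this
  calc ∑ i ∈ Finset.range j, a (k + 1 + i)
      ≤ ∑ i ∈ Finset.range j,
          M * ∫ x in ((k + i : ℕ) : ℝ)..((k + (i + 1) : ℕ) : ℝ), f x := by
        refine Finset.sum_le_sum fun i _ => ?_
        have := hterm (k + i) (by omega)
        rwa [show k + 1 + i = k + i + 1 by omega]
    _ = M * ∫ x in (k : ℝ)..((k + j : ℕ) : ℝ), f x := by rw [← Finset.mul_sum, hsum]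
    _ ≤ M * ∫ x in Set.Ioi (k : ℝ), f x := by
        refine mul_le_mul_of_nonneg_left ?_ hM0
        rw [intervalIntegral.integral_of_le (by push_cast; linarith [Nat.cast_nonneg (α := ℝ) j])]
        refine setIntegral_mono_set hint ?_ (Filter.Eventually.of_forall fun x hx => hx.1)
        filter_upwards [ae_restrict_mem measurableSet_Ioi] with x hx
        exact (hf_pos x (hk0.trans hx)).le
end

section
/- For every δ with 0 < δ < 1/2, setting x_k = k − k^{1/2+δ}, we have lim_{k→∞} e^{−x_k} ∑_{m=k−1}^∞ x_k^m/m! = 0, where the limit is over integers k → ∞. -/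
open Real Filter Topology

lemma poisson_tail_bound (x s : ℝ) (hx : 0 ≤ x) (hs : 0 ≤ s) (n : ℕ) :
    ∑' m : ℕ, x ^ (m + n) / (Nat.factorial (m + n) : ℝ)
      ≤ Real.exp (-(s * n)) * Real.exp (x * Real.exp s) := by
  have hS : ∀ y : ℝ, Summable (fun m : ℕ => y ^ m / (Nat.factorial m : ℝ)) :=
    fun y => Real.summable_pow_div_factorial y
  have hT : ∀ y : ℝ, Summable (fun m : ℕ => y ^ (m + n) / (Nat.factorial (m + n) : ℝ)) :=
    fun y => (summable_nat_add_iff n).2 (hS y)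
  have hy : 0 ≤ x * Real.exp s := by positivity
  have h1 : ∑' m : ℕ, (x * Real.exp s) ^ (m + n) / (Nat.factorial (m + n) : ℝ)
      ≤ Real.exp (x * Real.exp s) := by
    have h := (hS (x * Real.exp s)).sum_add_tsum_nat_add n
    have h2 : ∑' m : ℕ, (x * Real.exp s) ^ m / (Nat.factorial m : ℝ)
        = Real.exp (x * Real.exp s) := by
      rw [Real.exp_eq_exp_ℝ, NormedSpace.exp_eq_tsum_div]
    rw [h2] at h
    have h3 : 0 ≤ ∑ m ∈ Finset.range n, (x * Real.exp s) ^ m / (Nat.factorial m : ℝ) :=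
      Finset.sum_nonneg fun i _ => by positivity
    linarith
  calc _ ≤ ∑' m : ℕ, Real.exp (-(s * n)) *
        ((x * Real.exp s) ^ (m + n) / (Nat.factorial (m + n) : ℝ)) := by
        refine (hT x).tsum_le_tsum (fun m => ?_) ((hT _).mul_left _)
        rw [mul_pow, ← Real.exp_nat_mul]
        have : Real.exp (-(s * n)) * (x ^ (m + n) * Real.exp (((m + n : ℕ) : ℝ) * s) /
            (Nat.factorial (m + n) : ℝ)) =
            x ^ (m + n) / (Nat.factorial (m + n) : ℝ) * Real.exp (m * s) := by
          have : Real.exp (m * s) = Real.exp (-(s * n)) * Real.exp (((m + n : ℕ) : ℝ) * s) := by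
            rw [← Real.exp_add]; congr 1; push_cast; ring
          rw [this]; ring
        rw [this]
        exact le_mul_of_one_le_right (by positivity) (Real.one_le_exp (by positivity))
    _ ≤ _ := by
        rw [tsum_mul_left]
        gcongr

/-- For every `0 < δ < 1/2`, setting `x_k = k − k^(1/2+δ)`,
`lim_{k→∞} e^(−x_k) ∑_{m=k−1}^∞ x_k^m/m! = 0`. -/
theorem exp_mul_tsum_tail_tendsto_zero (δ : ℝ) (hδ0 : 0 < δ) (hδ : δ < 1 / 2) :
    Tendsto (fun k : ℕ =>
        Real.exp (-((k : ℝ) - (k : ℝ) ^ ((1 : ℝ) / 2 + δ))) *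
          ∑' m : ℕ, ((k : ℝ) - (k : ℝ) ^ ((1 : ℝ) / 2 + δ)) ^ (m + (k - 1))
            / (Nat.factorial (m + (k - 1)) : ℝ))
      atTop (𝓝 0) := by
  have hlim : Tendsto (fun k : ℕ => Real.exp (2 - (k : ℝ) ^ δ)) atTop (𝓝 0) := by
    refine Real.tendsto_exp_atBot.comp ?_
    have := (tendsto_rpow_atTop hδ0).comp (tendsto_natCast_atTop_atTop (R := ℝ))
    exact tendsto_atBot_add_const_left _ 2 (tendsto_neg_atTop_atBot.comp this)
  have hx : ∀ k : ℕ, 1 ≤ k → 0 ≤ (k : ℝ) - (k : ℝ) ^ ((1 : ℝ) / 2 + δ) := by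
    intro k hk
    have h1 : (1 : ℝ) ≤ k := by exact_mod_cast hk
    have := Real.rpow_le_rpow_of_exponent_le h1 (show (1 : ℝ) / 2 + δ ≤ 1 by linarith)
    rw [Real.rpow_one] at this
    linarith
  refine tendsto_of_tendsto_of_tendsto_of_le_of_le' tendsto_const_nhds hlim ?_ ?_
  · filter_upwards [eventually_ge_atTop 1] with k hk
    have := hx k hk
    exact mul_nonneg (Real.exp_pos _).le (tsum_nonneg fun m => by positivity)
  · filter_upwards [eventually_ge_atTop 1] with k hk
    have hx0 := hx k hk
    have h1 : (1 : ℝ) ≤ k := by exact_mod_cast hk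
    have hk0 : (0 : ℝ) < k := by linarith
    have hp : (k : ℝ) ^ (-(1 / 2) : ℝ) * (k : ℝ) ^ ((1 : ℝ) / 2 + δ) = (k : ℝ) ^ δ := by
      rw [← Real.rpow_add hk0]; congr 1; ring
    have hq : (k : ℝ) * ((k : ℝ) ^ (-(1 / 2) : ℝ)) ^ 2 = 1 := by
      rw [← Real.rpow_natCast, ← Real.rpow_mul hk0.le]
      norm_num
      rw [Real.rpow_neg_one, mul_inv_cancel₀ hk0.ne']
    have hs0 : 0 ≤ (k : ℝ) ^ (-(1 / 2) : ℝ) := by positivity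
    have hs1 : (k : ℝ) ^ (-(1 / 2) : ℝ) ≤ 1 :=
      Real.rpow_le_one_of_one_le_of_nonpos h1 (by norm_num)
    have hr : 0 ≤ (k : ℝ) ^ ((1 : ℝ) / 2 + δ) := by positivity
    generalize (k : ℝ) ^ (-(1 / 2) : ℝ) = s at *
    generalize (k : ℝ) ^ ((1 : ℝ) / 2 + δ) = r at *
    have he : Real.exp s ≤ 1 + s + s ^ 2 := by
      have := (abs_le.1 (Real.abs_exp_sub_one_sub_id_le (x := s)
        (by rw [abs_of_nonneg hs0]; exact hs1))).2
      linarith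
    have hb := poisson_tail_bound (k - r) s hx0 hs0 (k - 1)
    refine (mul_le_mul_of_nonneg_left hb (Real.exp_pos _).le).trans ?_
    rw [← Real.exp_add, ← Real.exp_add, Real.exp_le_exp, Nat.cast_sub hk, ← hp]
    have h5 := mul_le_mul_of_nonneg_left he hx0
    have h6 : 0 ≤ r * s ^ 2 := by positivity
    push_cast
    nlinarith
end

section
/- For every integer k ≥ 2 and every real x ≥ 16πk log k, Γ(k−1, x) ≤ 2 e^{−x/2}. -/
open Real MeasureTheory

theorem upperGamma_aux (k : ℕ) (hk : 2 ≤ k) (t : ℝ)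
    (ht : 16 * Real.pi * k * Real.log k ≤ t) :
    0 < t ∧ t ^ ((k : ℝ) - 1 - 1) * Real.exp (-t) ≤ Real.exp ((-1/2) * t) := by
  have hk' : (2 : ℝ) ≤ k := by exact_mod_cast hk
  have hl2 : Real.log 2 ≤ Real.log k := Real.log_le_log (by norm_num) hk'
  have h2 : (0.69 : ℝ) < Real.log 2 := by linarith [Real.log_two_gt_d9]
  have hkl : (1.38 : ℝ) ≤ k * Real.log k := by nlinarith
  have h48 : 48 * (k * Real.log k) ≤ t := by nlinarith [Real.pi_gt_three]
  have ht1 : 1 ≤ t := by linarith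
  have ht0 : 0 < t := by linarith
  refine ⟨ht0, ?_⟩
  rw [Real.rpow_def_of_pos ht0, ← Real.exp_add]
  apply Real.exp_le_exp.mpr
  have hlt : 0 ≤ Real.log t := Real.log_nonneg ht1
  have hk0 : (0 : ℝ) < k := by linarith
  have h1 := Real.log_le_sub_one_of_pos (show 0 < t / (4 * k) by positivity)
  rw [Real.log_div ht0.ne' (by positivity), Real.log_mul (by norm_num) hk0.ne',
    show (4 : ℝ) = 2 ^ 2 by norm_num, Real.log_pow] at h1
  push_cast at h1
  have h3 : Real.log t ≤ t / (2 ^ 2 * k) + 3 * Real.log k := by linarith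
  have h4 : k * Real.log t ≤ t / 4 + 3 * (k * Real.log k) := by
    calc k * Real.log t ≤ k * (t / (2 ^ 2 * k) + 3 * Real.log k) := by gcongr
      _ = _ := by field_simp; ring
  nlinarith

theorem upperGamma_le_two_exp (k : ℕ) (hk : 2 ≤ k) (x : ℝ)
    (hx : 16 * Real.pi * k * Real.log k ≤ x) :
    upperGamma ((k : ℝ) - 1) x ≤ 2 * Real.exp (-x / 2) := by
  have hI : ∫ t in Set.Ioi x, Real.exp ((-1/2) * t) = 2 * Real.exp (-x / 2) := by
    rw [integral_exp_mul_Ioi (by norm_num) x]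
    rw [show (-1/2 : ℝ) * x = -x / 2 by ring]; ring
  rw [← hI]
  unfold upperGamma
  apply integral_mono_of_nonneg
  · filter_upwards [ae_restrict_mem measurableSet_Ioi] with t ht
    have := (upperGamma_aux k hk t (hx.trans (le_of_lt ht))).1
    simp only [Pi.zero_apply]
    positivity
  · exact integrableOn_exp_mul_Ioi (by norm_num) x
  · filter_upwards [ae_restrict_mem measurableSet_Ioi] with t ht
    exact (upperGamma_aux k hk t (hx.trans (le_of_lt ht))).2
end

section
/- For every T > 0 and every ε₁ > 1, lim_{k→∞} (1/(k−2)!) ∑_{n ≥ ε₁ k/(4πT)} n · Γ(k−1, 4πnT) = 0, where the sum is over positive integers n ≥ ε₁k/(4πT) and the limit is over integers k → ∞ (k ≥ 3). -/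
open Real Filter Topology MeasureTheory

lemma upperGamma_nonneg' (s x : ℝ) (hx : 0 ≤ x) : 0 ≤ upperGamma s x := by
  unfold upperGamma
  apply setIntegral_nonneg measurableSet_Ioi
  intro t ht
  have : 0 ≤ t := hx.trans (le_of_lt ht)
  positivity

lemma upperGamma_le' (s x c : ℝ) (hs : 0 < s) (hx : 0 ≤ x) (hc : 1 < c) :
    upperGamma s x ≤ Real.exp (-((1 - 1 / c) * x)) * (c ^ s * Real.Gamma s) := by
  have hc0 : 0 < c := by linarith
  have hl : 0 ≤ 1 - 1 / c := by
    have : 1 / c ≤ 1 := by rw [div_le_one hc0]; exact hc.le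
    linarith
  have h := Real.integral_rpow_mul_exp_neg_mul_Ioi hs (one_div_pos.mpr hc0)
  rw [one_div_one_div] at h
  have hpos : 0 < c ^ s * Real.Gamma s := mul_pos (Real.rpow_pos_of_pos hc0 _) (Real.Gamma_pos_of_pos hs)
  have hint : IntegrableOn (fun t : ℝ => t ^ (s - 1) * Real.exp (-(1 / c * t))) (Set.Ioi 0) := by
    by_contra hn
    rw [integral_undef hn] at h
    linarith
  have hsub : Set.Ioi x ⊆ Set.Ioi (0:ℝ) := Set.Ioi_subset_Ioi hx
  have hintx := hint.mono_set hsub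
  have h1 : upperGamma s x ≤ ∫ t in Set.Ioi x,
      Real.exp (-((1 - 1 / c) * x)) * (t ^ (s - 1) * Real.exp (-(1 / c * t))) := by
    unfold upperGamma
    apply integral_mono_of_nonneg
    · filter_upwards [ae_restrict_mem measurableSet_Ioi] with t ht
      have : 0 ≤ t := hx.trans (le_of_lt ht)
      simp only [Pi.zero_apply]
      positivity
    · exact hintx.const_mul _
    · filter_upwards [ae_restrict_mem measurableSet_Ioi] with t ht
      have hxt : x ≤ t := le_of_lt ht
      have ht0 : 0 ≤ t := hx.trans hxt
      have : Real.exp (-t) ≤ Real.exp (-((1 - 1 / c) * x)) * Real.exp (-(1 / c * t)) := by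
        rw [← Real.exp_add]
        apply Real.exp_le_exp.mpr
        nlinarith [mul_le_mul_of_nonneg_left hxt hl]
      calc t ^ (s - 1) * Real.exp (-t)
          ≤ t ^ (s - 1) * (Real.exp (-((1 - 1 / c) * x)) * Real.exp (-(1 / c * t))) := by gcongr
        _ = _ := by ring
  refine h1.trans ?_
  rw [integral_const_mul, ← h]
  apply mul_le_mul_of_nonneg_left _ (Real.exp_pos _).le
  apply setIntegral_mono_set hint
  · filter_upwards [ae_restrict_mem measurableSet_Ioi] with t ht
    have : 0 ≤ t := le_of_lt ht
    simp only [Pi.zero_apply]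
    positivity
  · exact hsub.eventuallyLE

/-- For every `T > 0` and every `ε₁ > 1`,
`lim_{k→∞} (1/(k−2)!) ∑_{n ≥ ε₁k/(4πT)} n · Γ(k−1, 4πnT) = 0`, the sum being over
positive integers `n ≥ ε₁k/(4πT)`. -/
theorem tsum_upperGamma_tail_tendsto_zero (T ε₁ : ℝ) (hT : 0 < T) (hε : 1 < ε₁) :
    Tendsto (fun k : ℕ =>
        (1 / (Nat.factorial (k - 2) : ℝ)) *
          ∑' n : {n : ℕ // 0 < n ∧ ε₁ * k / (4 * Real.pi * T) ≤ (n : ℝ)},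
            ((n : ℕ) : ℝ) * upperGamma ((k : ℝ) - 1) (4 * Real.pi * ((n : ℕ) : ℝ) * T))
      atTop (𝓝 0) := by
  obtain ⟨c, hc1, hcε⟩ := exists_between hε
  have hc0 : 0 < c := by linarith
  have hε0 : 0 < ε₁ := by linarith
  have hl : 0 < 1 - 1 / c := by
    have : 1 / c < 1 := by rw [div_lt_one hc0]; exact hc1
    linarith
  have hd : 0 < 1 - c / ε₁ := by
    have : c / ε₁ < 1 := by rw [div_lt_one hε0]; exact hcε
    linarith
  have ha : 0 < 4 * Real.pi * T := by positivity
  set a := 4 * Real.pi * T with ha_def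
  set b := (1 - 1 / c) * (1 - c / ε₁) * a with hb_def
  have hb : 0 < b := by positivity
  set r := c * Real.exp (-(c - 1)) with hr_def
  have hr0 : 0 ≤ r := by positivity
  have hr1 : r < 1 := by
    have h2 : c < Real.exp (c - 1) := by
      have := Real.add_one_lt_exp (x := c - 1) (by linarith)
      linarith
    rw [hr_def, Real.exp_neg, ← div_eq_mul_inv, div_lt_one (Real.exp_pos _)]
    exact h2
  have hsum : Summable (fun n : ℕ => (n : ℝ) * Real.exp (-(b * n))) := by
    have := Real.summable_pow_mul_exp_neg_nat_mul 1 hb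
    refine this.congr fun n => ?_
    rw [pow_one, neg_mul]
  set S := ∑' n : ℕ, (n : ℝ) * Real.exp (-(b * n)) with hS
  have hlim : Tendsto (fun k : ℕ => S * r ^ k) atTop (𝓝 0) := by
    simpa using (tendsto_pow_atTop_nhds_zero_of_lt_one hr0 hr1).const_mul S
  refine squeeze_zero' ?_ ?_ hlim
  · refine Eventually.of_forall fun k => ?_
    refine mul_nonneg (by positivity) (tsum_nonneg fun n => ?_)
    exact mul_nonneg (by positivity) (upperGamma_nonneg' _ _ (by positivity))
  · filter_upwards [eventually_ge_atTop 2] with k hk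
    obtain ⟨m, rfl⟩ := Nat.exists_eq_add_of_le' hk
    have hs : (((m + 2 : ℕ) : ℝ) - 1) = (m : ℝ) + 1 := by push_cast; ring
    rw [hs, Nat.add_sub_cancel]
    have hF : (0 : ℝ) < (m.factorial : ℝ) := by positivity
    have key : ∀ n : {n : ℕ // 0 < n ∧ ε₁ * (m + 2 : ℕ) / a ≤ (n : ℝ)},
        ((n : ℕ) : ℝ) * upperGamma ((m : ℝ) + 1) (4 * Real.pi * ((n : ℕ) : ℝ) * T)
          ≤ (m.factorial * r ^ (m + 2)) * (((n : ℕ) : ℝ) * Real.exp (-(b * (n : ℕ)))) := by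
      rintro ⟨n, hn0, hn⟩
      simp only
      have hx : 4 * Real.pi * (n : ℝ) * T = a * n := by rw [ha_def]; ring
      rw [hx]
      have h1 := upperGamma_le' ((m : ℝ) + 1) (a * n) c (by positivity) (by positivity) hc1
      rw [Real.Gamma_nat_eq_factorial] at h1
      have h2 : c ^ ((m : ℝ) + 1) ≤ c ^ (m + 2) := by
        rw [← Real.rpow_natCast c (m + 2)]
        apply Real.rpow_le_rpow_of_exponent_le hc1.le
        push_cast; linarith
      rw [div_le_iff₀ ha] at hn
      have h3 : Real.exp (-((1 - 1 / c) * (a * n)))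
          ≤ Real.exp (-(c - 1)) ^ (m + 2) * Real.exp (-(b * n)) := by
        rw [← Real.exp_nat_mul, ← Real.exp_add]
        apply Real.exp_le_exp.mpr
        have h4 : (1 - 1 / c) * (c / ε₁) * (ε₁ * (m + 2 : ℕ)) ≤ (1 - 1 / c) * (c / ε₁) * (n * a) :=
          mul_le_mul_of_nonneg_left hn (by positivity)
        have h5 : (1 - 1 / c) * (c / ε₁) * (ε₁ * (m + 2 : ℕ)) = (c - 1) * (m + 2 : ℕ) := by
          field_simp
        have h6 : (1 - 1 / c) * (a * n) = (1 - 1 / c) * (c / ε₁) * (n * a) + b * n := by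
          rw [hb_def]; ring
        rw [h6]
        linarith
      calc (n : ℝ) * upperGamma ((m : ℝ) + 1) (a * n)
          ≤ n * ((Real.exp (-(c - 1)) ^ (m + 2) * Real.exp (-(b * n))) *
              (c ^ (m + 2) * m.factorial)) := by
            refine mul_le_mul_of_nonneg_left (h1.trans ?_) (by positivity)
            gcongr
        _ = _ := by rw [hr_def, mul_pow]; ring
    have hsub := hsum.mul_left (m.factorial * r ^ (m + 2))
    have hsub2 := hsub.subtype {n : ℕ | 0 < n ∧ ε₁ * (m + 2 : ℕ) / a ≤ (n : ℝ)}
    have hle1 := Summable.tsum_le_tsum key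
      (Summable.of_nonneg_of_le (fun n => mul_nonneg (by positivity)
        (upperGamma_nonneg' _ _ (by positivity))) key hsub2) hsub2
    have hle2 := Summable.tsum_subtype_le _ {n : ℕ | 0 < n ∧ ε₁ * (m + 2 : ℕ) / a ≤ (n : ℝ)}
      (fun n => by positivity) hsub
    have hle := hle1.trans hle2
    rw [tsum_mul_left] at hle
    rw [one_div, inv_mul_le_iff₀ hF]
    refine hle.trans (le_of_eq ?_)
    rw [hS]; ring
end
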